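/- There is no non-blocking linearizable implementation of the sequential stack from read/write registers for two or more asynchronous crash-prone processes: if such an implementation existed, two processes could solve consensus using only read/write registers (by initializing the stack with a single item 'winner' and having each process Pop), contradicting the fact that consensus for two processes cannot be solved wait-free from read/write registers. -/

import Mathlib

/-- Operations of a stack over items in ℕ. -/
inductive StackOp
  | push (x : ℕ)
  | pop
  deriving DecidableEq

/-- Possible outputs: `ok` (= true, for push), an item, or empty (ε). -/
inductive StackRes
  | ok
  | val (x : ℕ)
  | empty
  deriving DecidableEq

/-- The next action of a process of an algorithm using only read/write registers:
read a register (continuing according to the value read), write a value to a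
register, or return a result to the operation being executed. -/
inductive RWAction (Reg Val Loc Res : Type)
  | read (r : Reg) (k : Val → Loc)
  | write (r : Reg) (v : Val) (k : Loc)
  | ret (res : Res)

/-- An implementation of an object with operations `Op` and results `Res` for `n`
asynchronous processes from read/write registers only: a set `Reg` of registers
holding values in `Val` with initial values `initVal`, and for each process a
deterministic local state machine over local states `Loc`: `start i op` is the
local state of process `i` upon invoking `op`, and `act i l` the next action of
process `i` in local state `l`. -/
structure RWImpl (n : ℕ) (Op Res Reg Val Loc : Type) where
  initVal : Reg → Val
  start : Fin n → Op → Loc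
  act : Fin n → Loc → RWAction Reg Val Loc Res

/-- A record of a completed operation. -/
structure LogEntry (n : ℕ) (Op Res : Type) where
  proc : Fin n
  op : Op
  res : Res
  invT : ℕ
  retT : ℕ

/-- A configuration of the system: the register contents, the local state of each
process (`none` = idle), the pending operation of each process (with invocation
time), the log of completed operations and the global time. -/
structure Config (n : ℕ) (Op Res Reg Val Loc : Type) where
  regs : Reg → Val
  proc : Fin n → Option Loc
  pend : Fin n → Option (Op × ℕ)
  log : List (LogEntry n Op Res)
  time : ℕ

/-- The initial configuration of an implementation. -/
def initConfig {n : ℕ} {Op Res Reg Val Loc : Type} (A : RWImpl n Op Res Reg Val Loc) :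
    Config n Op Res Reg Val Loc :=
  { regs := A.initVal
    proc := fun _ => none
    pend := fun _ => none
    log := []
    time := 0 }

/-- One atomic step of process `i`: an invocation (of an arbitrary operation,
chosen by the environment), an atomic read or write of a register as dictated by
the implementation, or a response. -/
inductive Step {n : ℕ} {Op Res Reg Val Loc : Type} (A : RWImpl n Op Res Reg Val Loc) :
    Config n Op Res Reg Val Loc → Fin n → Config n Op Res Reg Val Loc → Prop
  | inv (c : Config n Op Res Reg Val Loc) (i : Fin n) (op : Op)
      (h : c.proc i = none) (hp : c.pend i = none) :
      Step A c i { c with proc := Function.update c.proc i (some (A.start i op)),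
                          pend := Function.update c.pend i (some (op, c.time)),
                          time := c.time + 1 }
  | read (c : Config n Op Res Reg Val Loc) (i : Fin n) (l : Loc) (r : Reg)
      (k : Val → Loc) (h : c.proc i = some l) (ha : A.act i l = RWAction.read r k) :
      Step A c i { c with proc := Function.update c.proc i (some (k (c.regs r))),
                          time := c.time + 1 }
  | write (c : Config n Op Res Reg Val Loc) (i : Fin n) (l : Loc) (r : Reg)
      (v : Val) (k : Loc) (regs' : Reg → Val)
      (h : c.proc i = some l) (ha : A.act i l = RWAction.write r v k)
      (hw : regs' r = v) (ho : ∀ r', r' ≠ r → regs' r' = c.regs r') :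
      Step A c i { c with regs := regs',
                          proc := Function.update c.proc i (some k),
                          time := c.time + 1 }
  | ret (c : Config n Op Res Reg Val Loc) (i : Fin n) (l : Loc) (res : Res)
      (op : Op) (t0 : ℕ)
      (h : c.proc i = some l) (ha : A.act i l = RWAction.ret res)
      (hp : c.pend i = some (op, t0)) :
      Step A c i { c with proc := Function.update c.proc i none,
                          pend := Function.update c.pend i none,
                          log := c.log ++ [⟨i, op, res, t0, c.time⟩],
                          time := c.time + 1 }

/-- An (infinite) execution of the implementation `A`. -/
def Run {n : ℕ} {Op Res Reg Val Loc : Type} (A : RWImpl n Op Res Reg Val Loc)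
    (c : ℕ → Config n Op Res Reg Val Loc) (sched : ℕ → Fin n) : Prop :=
  c 0 = initConfig A ∧ ∀ k, Step A (c k) (sched k) (c (k + 1))

/-- A concurrent history: `m` operations, each with its kind, its invocation time,
and, if completed, its response time and its output (`none` = pending). -/
structure ConcHistory (Op Res : Type) where
  m : ℕ
  op : Fin m → Op
  inv : Fin m → ℕ
  ret : Fin m → Option ℕ
  out : Fin m → Option Res

/-- `op i` precedes `op j`: the response of `i` occurs before the invocation of `j`. -/
def ConcHistory.precedes {Op Res : Type} (h : ConcHistory Op Res) (i j : Fin h.m) : Prop :=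
  ∃ t, h.ret i = some t ∧ t < h.inv j

/-- The pending operations of a configuration. -/
def pendingList {n : ℕ} {Op Res Reg Val Loc : Type} (cfg : Config n Op Res Reg Val Loc) :
    List (Op × ℕ) :=
  (List.finRange n).filterMap cfg.pend

/-- The history of a configuration (for the stack interface): its completed
operations (from the log) followed by its pending operations. -/
def historyAt {n : ℕ} {Reg Val Loc : Type} (cfg : Config n StackOp StackRes Reg Val Loc) :
    ConcHistory StackOp StackRes where
  m := cfg.log.length + (pendingList cfg).length
  op := fun k =>
    if hk : (k : ℕ) < cfg.log.length then (cfg.log.get ⟨k, hk⟩).op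
    else ((pendingList cfg).getD ((k : ℕ) - cfg.log.length) (StackOp.pop, 0)).1
  inv := fun k =>
    if hk : (k : ℕ) < cfg.log.length then (cfg.log.get ⟨k, hk⟩).invT
    else ((pendingList cfg).getD ((k : ℕ) - cfg.log.length) (StackOp.pop, 0)).2
  ret := fun k =>
    if hk : (k : ℕ) < cfg.log.length then some (cfg.log.get ⟨k, hk⟩).retT else none
  out := fun k =>
    if hk : (k : ℕ) < cfg.log.length then some (cfg.log.get ⟨k, hk⟩).res else none

/-- Transition of the sequential stack. -/
def SeqStackDelta (q : List ℕ) (p : StackOp × StackRes) (q' : List ℕ) : Prop :=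
  (∃ x, p = (StackOp.push x, StackRes.ok) ∧ q' = x :: q) ∨
  (∃ x, q = x :: q' ∧ p = (StackOp.pop, StackRes.val x)) ∨
  (q = [] ∧ q' = [] ∧ p = (StackOp.pop, StackRes.empty))

/-- A sequential execution of the sequential stack. -/
inductive SeqStackExec : List ℕ → List (StackOp × StackRes) → List ℕ → Prop
  | nil (q : List ℕ) : SeqStackExec q [] q
  | cons {q q' q'' : List ℕ} {p : StackOp × StackRes} {ps : List (StackOp × StackRes)} :
      SeqStackDelta q p q' → SeqStackExec q' ps q'' → SeqStackExec q (p :: ps) q''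

/-- A linearization of a history `h` w.r.t. the sequential stack. -/
structure Linearization (h : ConcHistory StackOp StackRes) where
  seq : List (Fin h.m)
  lout : Fin h.m → StackRes
  nodup : seq.Nodup
  complete_mem : ∀ i, (h.out i).isSome → i ∈ seq
  out_agree : ∀ i r, h.out i = some r → lout i = r
  order : ∀ k1 k2 : Fin seq.length,
    h.precedes (seq.get k1) (seq.get k2) → (k1 : ℕ) < (k2 : ℕ)
  valid : ∃ qf, SeqStackExec [] (seq.map (fun i => (h.op i, lout i))) qf

/-- An implementation is non-blocking: in every infinite execution infinitely many
invocations are completed. -/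
def NonBlocking {n : ℕ} {Op Res Reg Val Loc : Type} (A : RWImpl n Op Res Reg Val Loc) : Prop :=
  ∀ (c : ℕ → Config n Op Res Reg Val Loc) (sched : ℕ → Fin n),
    Run A c sched → ∀ m : ℕ, ∃ k, m ≤ (c k).log.length

/-- An implementation of the stack is linearizable: every execution (every finite
prefix of every run) is linearizable w.r.t. the sequential stack. -/
def LinearizableImpl {n : ℕ} {Reg Val Loc : Type}
    (A : RWImpl n StackOp StackRes Reg Val Loc) : Prop :=
  ∀ (c : ℕ → Config n StackOp StackRes Reg Val Loc) (sched : ℕ → Fin n),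
    Run A c sched → ∀ N : ℕ, Nonempty (Linearization (historyAt (c N)))

section Protocol

variable {Reg Val Loc Res : Type}

open Classical in
/-- The registers and local state after a read or write of a process with program `a`;
`none` if the process is about to return. -/
noncomputable def advance (a : Loc → RWAction Reg Val Loc Res) (R : Reg → Val) (l : Loc) :
    Option ((Reg → Val) × Loc) :=
  match a l with
  | .read r k => some (R, k (R r))
  | .write r v k => some (Function.update R r v, k)
  | .ret _ => none

theorem advance_eq_none {a : Loc → RWAction Reg Val Loc Res} {R : Reg → Val} {l : Loc} :
    advance a R l = none ↔ ∃ r, a l = .ret r := by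
  unfold advance
  cases a l <;> simp

/-- Running alone from registers `R` and local state `l`, the program `a` returns `res`. -/
inductive SoloReturns (a : Loc → RWAction Reg Val Loc Res) :
    (Reg → Val) → Loc → Res → Prop
  | done {R : Reg → Val} {l : Loc} {res : Res} (h : a l = .ret res) : SoloReturns a R l res
  | step {R R' : Reg → Val} {l l' : Loc} {res : Res} (h : advance a R l = some (R', l'))
      (hs : SoloReturns a R' l' res) : SoloReturns a R l res

theorem SoloReturns.eq_of_ret {a : Loc → RWAction Reg Val Loc Res} {R : Reg → Val} {l : Loc}
    {res res' : Res} (h : SoloReturns a R l res) (hr : a l = .ret res') : res = res' := by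
  cases h with
  | done h => rw [h] at hr; injection hr
  | step h _ => rw [advance_eq_none.2 ⟨_, hr⟩] at h; cases h

theorem SoloReturns.of_advance {a : Loc → RWAction Reg Val Loc Res} {R R' : Reg → Val}
    {l l' : Loc} {res : Res} (h : SoloReturns a R l res)
    (ha : advance a R l = some (R', l')) : SoloReturns a R' l' res := by
  cases h with
  | done h => rw [advance_eq_none.2 ⟨_, h⟩] at ha; cases ha
  | step h hs =>
    rw [h] at ha
    cases ha
    exact hs

theorem SoloReturns.unique {a : Loc → RWAction Reg Val Loc Res} {R : Reg → Val} {l : Loc}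
    {res res' : Res} (h : SoloReturns a R l res) (h' : SoloReturns a R l res') :
    res = res' := by
  induction h with
  | done h => exact (h'.eq_of_ret h).symm
  | step h _ ih => exact ih (h'.of_advance h)

/-- A read or write by one of two processes running the programs `a true` and `a false`. -/
def PairStep (a : Bool → Loc → RWAction Reg Val Loc Res)
    (s s' : (Reg → Val) × (Bool → Loc)) : Prop :=
  ∃ b R' l', advance (a b) s.1 (s.2 b) = some (R', l') ∧ s' = (R', Function.update s.2 b l')

theorem exists_soloReturns_of_acc {a : Bool → Loc → RWAction Reg Val Loc Res}
    {s : (Reg → Val) × (Bool → Loc)} (hs : Acc (fun s' s => PairStep a s s') s) (b : Bool) :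
    ∃ r, SoloReturns (a b) s.1 (s.2 b) r := by
  induction hs with
  | intro s _ ih =>
    rcases h : advance (a b) s.1 (s.2 b) with _ | ⟨R', l'⟩
    · obtain ⟨r, hr⟩ := advance_eq_none.1 h
      exact ⟨r, .done hr⟩
    · obtain ⟨r, hr⟩ := ih _ ⟨b, R', l', h, rfl⟩
      simp only [Function.update_self] at hr
      exact ⟨r, .step h hr⟩

theorem SoloReturns.exists_reflTransGen {a : Bool → Loc → RWAction Reg Val Loc Res} {b : Bool}
    {R : Reg → Val} {l : Loc} {r : Res} (h : SoloReturns (a b) R l r) :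
    ∀ f : Bool → Loc, f b = l → ∃ s', Relation.ReflTransGen (PairStep a) (R, f) s' ∧
      s'.2 (!b) = f (!b) ∧ a b (s'.2 b) = .ret r := by
  induction h with
  | done h =>
    rintro f rfl
    exact ⟨_, .refl, rfl, h⟩
  | @step R R' l l' r h _ ih =>
    rintro f rfl
    obtain ⟨s', h1, h2, h3⟩ := ih (Function.update f b l') (by simp)
    refine ⟨s', .head ⟨b, R', l', h, rfl⟩ h1, ?_, h3⟩
    rw [h2, Function.update_of_ne (by simp)]

/-- Of two pending read/write steps, either one is invisible to a solo run of the process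
performing the other, or the two steps commute. -/
theorem advance_cases (a₁ a₂ : Loc → RWAction Reg Val Loc Res) {R R₁ R₂ : Reg → Val}
    {l₁ l₂ l₁' l₂' : Loc} (h₁ : advance a₁ R l₁ = some (R₁, l₁'))
    (h₂ : advance a₂ R l₂ = some (R₂, l₂')) :
    R₁ = R ∨ R₂ = R ∨ advance a₂ R₁ l₂ = some (R₂, l₂') ∨
      ∃ R₃, advance a₂ R₁ l₂ = some (R₃, l₂') ∧ advance a₁ R₂ l₁ = some (R₃, l₁') := by
  classical
  unfold advance at *
  rcases ha₁ : a₁ l₁ with ⟨r₁, k₁⟩ | ⟨r₁, v₁, k₁⟩ | _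
  · simp_all
  · rcases ha₂ : a₂ l₂ with ⟨r₂, k₂⟩ | ⟨r₂, v₂, k₂⟩ | _
    · simp_all
    · simp only [ha₁, ha₂, Option.some.injEq, Prod.mk.injEq] at h₁ h₂ ⊢
      obtain ⟨rfl, rfl⟩ := h₁
      obtain ⟨rfl, rfl⟩ := h₂
      by_cases hr : r₁ = r₂
      · subst hr
        simp
      · exact .inr (.inr (.inr ⟨_, ⟨rfl, rfl⟩, Function.update_comm (Ne.symm hr) _ _ _, rfl⟩))
    · simp_all
  · simp_all

/-- The solo runs of the two processes from `s` both win or both lose. -/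
def Undecided (a : Bool → Loc → RWAction Reg Val Loc Res) (w : Res)
    (s : (Reg → Val) × (Bool → Loc)) : Prop :=
  ∃ r : Bool → Res, (∀ b, SoloReturns (a b) s.1 (s.2 b) (r b)) ∧ (r true = w ↔ r false = w)

theorem Undecided.advance_isSome {a : Bool → Loc → RWAction Reg Val Loc Res} {w : Res}
    {s : (Reg → Val) × (Bool → Loc)} (hu : Undecided a w s)
    (hagree : ∀ s', Relation.ReflTransGen (PairStep a) s s' → ∀ r : Bool → Res,
      (∀ b, a b (s'.2 b) = .ret (r b)) → ¬ (r true = w ↔ r false = w)) (b : Bool) :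
    ∃ R' l', advance (a b) s.1 (s.2 b) = some (R', l') := by
  rcases h : advance (a b) s.1 (s.2 b) with _ | ⟨R', l'⟩
  · obtain ⟨x, hx⟩ := advance_eq_none.1 h
    obtain ⟨r, hr, hw⟩ := hu
    obtain ⟨s', h1, h2, h3⟩ := (hr (!b)).exists_reflTransGen s.2 rfl
    rw [Bool.not_not] at h2
    refine absurd hw (hagree s' h1 r fun b' => ?_)
    rcases eq_or_ne b' b with rfl | hb
    · rw [h2, (hr b').eq_of_ret hx, hx]
    · obtain rfl : b' = !b := by revert hb; cases b <;> cases b' <;> simp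
      exact h3
  · exact ⟨R', l', rfl⟩

/-- From an undecided state with both steps pending, one or two steps lead to an undecided
state. -/
theorem Undecided.exists_transGen {a : Bool → Loc → RWAction Reg Val Loc Res} {w : Res}
    {s : (Reg → Val) × (Bool → Loc)} (hu : Undecided a w s)
    (hacc : Acc (fun s' s => PairStep a s s') s)
    (hadv : ∀ b, ∃ R' l', advance (a b) s.1 (s.2 b) = some (R', l')) :
    ∃ s', Relation.TransGen (PairStep a) s s' ∧ Undecided a w s' := by
  obtain ⟨r, hr, hw⟩ := hu
  choose R' l' h using hadv
  have hstep : ∀ b, PairStep a s (R' b, Function.update s.2 b (l' b)) :=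
    fun b => ⟨b, _, _, h b, rfl⟩
  have hsolo : ∀ b, ∃ x, SoloReturns (a (!b)) (R' b) (s.2 (!b)) x := by
    intro b
    obtain ⟨x, hx⟩ := exists_soloReturns_of_acc (hacc.inv (hstep b)) (!b)
    exact ⟨x, by simpa using hx⟩
  choose x hx using hsolo
  have hone : ∀ b, (x b = w ↔ r b = w) → ∃ s', Relation.TransGen (PairStep a) s s' ∧
      Undecided a w s' := by
    intro b hxb
    refine ⟨_, .single (hstep b), fun b' => if b' = b then r b else x b, ?_, ?_⟩
    · intro b'
      rcases eq_or_ne b' b with rfl | hb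
      · simpa using (hr b').of_advance (h b')
      · obtain rfl : b' = !b := by revert hb; cases b <;> cases b' <;> simp
        simpa using hx b
    · cases b <;> simp [hxb]
  rcases advance_cases _ _ (h true) (h false) with h0 | h0 | h0 | ⟨R₃, h0, h1⟩
  · have := hx true
    rw [h0] at this
    exact hone true (by rw [this.unique (hr false), hw])
  · have := hx false
    rw [h0] at this
    exact hone false (by rw [this.unique (hr true), hw])
  · have := ((hx true).of_advance h0).unique ((hr false).of_advance (h false))
    exact hone true (by rw [this, hw])
  · by_cases hxt : x true = w ↔ r true = w
    · exact hone true hxt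
    by_cases hxf : x false = w ↔ r false = w
    · exact hone false hxf
    refine ⟨(R₃, Function.update (Function.update s.2 true (l' true)) false (l' false)),
      .tail (.single (hstep true)) ⟨false, R₃, l' false, ?_, rfl⟩, fun b => x (!b), ?_, ?_⟩
    · simpa using h0
    · rintro (_ | _)
      · simpa using (hx true).of_advance h0
      · simpa using (hx false).of_advance h1
    · simp only [Bool.not_true, Bool.not_false]
      tauto

/-- Two processes cannot elect a winner with registers only. -/
theorem no_rw_election (a : Bool → Loc → RWAction Reg Val Loc Res) (w : Res)
    (s₀ : (Reg → Val) × (Bool → Loc))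
    (hacc : Acc (fun s' s => PairStep a s s') s₀)
    (hagree : ∀ s, Relation.ReflTransGen (PairStep a) s₀ s → ∀ r : Bool → Res,
      (∀ b, a b (s.2 b) = .ret (r b)) → ¬ (r true = w ↔ r false = w))
    (hsolo : ∀ b r, SoloReturns (a b) s₀.1 (s₀.2 b) r → r = w) : False := by
  have hu : Undecided a w s₀ := by
    choose r hr using exists_soloReturns_of_acc hacc
    exact ⟨r, hr, by simp [fun b => hsolo b _ (hr b)]⟩
  clear hsolo
  have hacc' := hacc.transGen
  induction hacc' with
  | intro s _ ih =>
    obtain ⟨s', hs', hu'⟩ := hu.exists_transGen hacc (hu.advance_isSome hagree)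
    have hswap : Relation.TransGen (fun s' s => PairStep a s s') s' s :=
      Relation.transGen_swap.1 hs'
    refine ih s' hswap ?_ (fun t ht => hagree t (hs'.to_reflTransGen.trans ht)) hu'
    exact acc_transGen_iff.1 (hacc.transGen.inv hswap)

end Protocol

section Executions

variable {n : ℕ} {Op Res Reg Val Loc : Type}

/-- Reachability by finitely many steps. -/
def Reaches (A : RWImpl n Op Res Reg Val Loc) :
    Config n Op Res Reg Val Loc → Config n Op Res Reg Val Loc → Prop :=
  Relation.ReflTransGen (fun c c' => ∃ i, Step A c i c')

/-- An infinite execution fragment starting at `c₀`. -/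
def RunFrom (A : RWImpl n Op Res Reg Val Loc) (c₀ : Config n Op Res Reg Val Loc)
    (c : ℕ → Config n Op Res Reg Val Loc) (sched : ℕ → Fin n) : Prop :=
  c 0 = c₀ ∧ ∀ k, Step A (c k) (sched k) (c (k + 1))

theorem Reaches.exists_run {A : RWImpl n Op Res Reg Val Loc}
    {c₀ c₁ : Config n Op Res Reg Val Loc} (h : Reaches A c₀ c₁)
    {c : ℕ → Config n Op Res Reg Val Loc} {sched : ℕ → Fin n} (hc : RunFrom A c₁ c sched) :
    ∃ d sched' N, RunFrom A c₀ d sched' ∧ ∀ k, d (N + k) = c k := by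
  induction h using Relation.ReflTransGen.head_induction_on with
  | refl => exact ⟨c, sched, 0, hc, by simp⟩
  | @head e e' he _ ih =>
    obtain ⟨i, hi⟩ := he
    obtain ⟨d, sched', N, ⟨hd0, hd⟩, hN⟩ := ih
    refine ⟨fun k => Nat.casesOn k e d, fun k => Nat.casesOn k i sched', N + 1, ⟨rfl, ?_⟩, ?_⟩
    · rintro (_ | k)
      · simpa [hd0] using hi
      · exact hd k
    · intro k
      rw [Nat.add_right_comm]
      exact hN k

theorem Step.log_length_le {A : RWImpl n Op Res Reg Val Loc}
    {c c' : Config n Op Res Reg Val Loc} {i : Fin n} (h : Step A c i c') :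
    c.log.length ≤ c'.log.length := by
  cases h <;> simp

/-- A step that completes no operation. -/
def SilentStep (A : RWImpl n Op Res Reg Val Loc) (c c' : Config n Op Res Reg Val Loc) : Prop :=
  (∃ i, Step A c i c') ∧ c'.log = c.log

theorem NonBlocking.acc_silentStep {A : RWImpl n Op Res Reg Val Loc} (hA : NonBlocking A)
    {c : Config n Op Res Reg Val Loc} (hc : Reaches A (initConfig A) c) :
    Acc (fun c' c => SilentStep A c c') c := by
  by_contra hacc
  obtain ⟨f, hf0, hf⟩ := not_acc_iff_exists_descending_chain.1 hacc
  choose i hi using fun k => (hf k).1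
  have hlog : ∀ k, (f k).log = c.log := by
    intro k
    induction k with
    | zero => rw [hf0]
    | succ k ih => rw [(hf k).2, ih]
  obtain ⟨d, sched, N, hd, hN⟩ := hc.exists_run (c := f) (sched := i) ⟨hf0, hi⟩
  have hmono : Monotone fun k => (d k).log.length :=
    monotone_nat_of_le_succ fun k => (hd.2 k).log_length_le
  obtain ⟨k, hk⟩ := hA d sched hd (c.log.length + 1)
  have := hmono (Nat.le_add_left k N)
  simp only [hN, hlog] at this
  omega

theorem step_of_advance {A : RWImpl n Op Res Reg Val Loc} {c : Config n Op Res Reg Val Loc}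
    {i : Fin n} {l l' : Loc} {R' : Reg → Val} (h : c.proc i = some l)
    (ha : advance (A.act i) c.regs l = some (R', l')) :
    Step A c i { c with regs := R', proc := Function.update c.proc i (some l'),
                        time := c.time + 1 } := by
  unfold advance at ha
  rcases hact : A.act i l with ⟨r, k⟩ | ⟨r, v, k⟩ | _
  · simp only [hact, Option.some.injEq, Prod.mk.injEq] at ha
    obtain ⟨rfl, rfl⟩ := ha
    exact .read c i l r k h hact
  · simp only [hact, Option.some.injEq, Prod.mk.injEq] at ha
    obtain ⟨rfl, rfl⟩ := ha
    exact .write c i l r v k _ h hact (by simp) (fun r' hr' => by simp [hr'])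
  · simp [hact] at ha

/-- A process that is busy exactly when it has a pending operation can always take steps. -/
theorem exists_runFrom (A : RWImpl n Op Res Reg Val Loc) [Nonempty Op]
    {c₀ : Config n Op Res Reg Val Loc} {i : Fin n} (h₀ : c₀.proc i = none ↔ c₀.pend i = none) :
    ∃ c sched, RunFrom A c₀ c sched := by
  have hnext : ∀ c : {c : Config n Op Res Reg Val Loc // c.proc i = none ↔ c.pend i = none},
      ∃ c' : {c : Config n Op Res Reg Val Loc // c.proc i = none ↔ c.pend i = none},
        Step A c.1 i c'.1 := by
    rintro ⟨c, hc⟩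
    rcases hl : c.proc i with _ | l
    · exact ⟨⟨_, by simp⟩, .inv c i (Classical.arbitrary Op) hl (hc.1 hl)⟩
    · rcases hp : c.pend i with _ | ⟨op, t⟩
      · simp [hl, hp] at hc
      · rcases ha : advance (A.act i) c.regs l with _ | ⟨R', l'⟩
        · obtain ⟨r, hr⟩ := advance_eq_none.1 ha
          exact ⟨⟨_, by simp⟩, .ret c i l r op t hl hr hp⟩
        · exact ⟨⟨_, by simp [hp]⟩, step_of_advance hl ha⟩
  choose next hstep using hnext
  refine ⟨fun k => (next^[k] ⟨c₀, h₀⟩).1, fun _ => i, rfl, fun k => ?_⟩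
  simpa only [Function.iterate_succ_apply'] using hstep _

theorem exists_soloReturns_of_acc_silentStep {A : RWImpl n Op Res Reg Val Loc}
    {c : Config n Op Res Reg Val Loc} (hc : Acc (fun c' c => SilentStep A c c') c) {i : Fin n}
    {l : Loc} (hl : c.proc i = some l) : ∃ r, SoloReturns (A.act i) c.regs l r := by
  induction hc generalizing l with
  | intro c _ ih =>
    rcases ha : advance (A.act i) c.regs l with _ | ⟨R', l'⟩
    · obtain ⟨r, hr⟩ := advance_eq_none.1 ha
      exact ⟨r, .done hr⟩
    · obtain ⟨r, hr⟩ := ih _ ⟨⟨i, step_of_advance hl ha⟩, rfl⟩ (l := l') (by simp)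
      exact ⟨r, .step ha hr⟩

theorem SoloReturns.exists_reaches {A : RWImpl n Op Res Reg Val Loc} {i : Fin n}
    {R : Reg → Val} {l : Loc} {r : Res} (h : SoloReturns (A.act i) R l r) :
    ∀ {c : Config n Op Res Reg Val Loc} {op : Op} {t₀ : ℕ}, c.regs = R → c.proc i = some l →
      c.pend i = some (op, t₀) → ∃ c' t, Reaches A c c' ∧
        c'.log = c.log ++ [⟨i, op, r, t₀, t⟩] ∧ c'.proc = Function.update c.proc i none ∧
        c'.pend = Function.update c.pend i none ∧ t < c'.time := by
  induction h with
  | done h =>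
    intro c op t₀ _ hl hp
    exact ⟨_, c.time, .single ⟨i, .ret c i _ _ op t₀ hl h hp⟩, rfl, rfl, rfl,
      Nat.lt_succ_self _⟩
  | @step R R' l l' r h _ ih =>
    rintro c op t₀ rfl hl hp
    have hs := step_of_advance hl h
    obtain ⟨c', t, h1, h2, h3, h4, h5⟩ := ih (c := { c with
      regs := R', proc := Function.update c.proc i (some l'), time := c.time + 1 })
      rfl (by simp) hp
    exact ⟨c', t, .head ⟨i, hs⟩ h1, h2, by simpa using h3, h4, h5⟩

/-- The two-process state `s` describes the registers and the processes `π true` and `π false`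
of `c`. -/
def Simulates (π : Bool → Fin n) (c : Config n Op Res Reg Val Loc)
    (s : (Reg → Val) × (Bool → Loc)) : Prop :=
  c.regs = s.1 ∧ ∀ b, c.proc (π b) = some (s.2 b)

theorem Simulates.exists_silentStep {A : RWImpl n Op Res Reg Val Loc} {π : Bool → Fin n}
    (hπ : Function.Injective π) {c : Config n Op Res Reg Val Loc}
    {s s' : (Reg → Val) × (Bool → Loc)} (hc : Simulates π c s)
    (hs : PairStep (fun b => A.act (π b)) s s') :
    ∃ c', SilentStep A c c' ∧ Simulates π c' s' ∧ c'.pend = c.pend ∧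
      ∀ j, (∀ b, j ≠ π b) → c'.proc j = c.proc j := by
  obtain ⟨b, R', l', ha, rfl⟩ := hs
  rw [← hc.1] at ha
  refine ⟨_, ⟨⟨π b, step_of_advance (hc.2 b) ha⟩, rfl⟩, ⟨rfl, fun b' => ?_⟩, rfl,
    fun j hj => Function.update_of_ne (hj b) _ _⟩
  rcases eq_or_ne b' b with rfl | hb
  · simp
  · simp [hb, hπ.eq_iff, hc.2 b']

theorem Simulates.acc_pairStep {A : RWImpl n Op Res Reg Val Loc} {π : Bool → Fin n}
    (hπ : Function.Injective π) {c : Config n Op Res Reg Val Loc}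
    {s : (Reg → Val) × (Bool → Loc)} (hc : Simulates π c s)
    (hacc : Acc (fun c' c => SilentStep A c c') c) :
    Acc (fun s' s => PairStep (fun b => A.act (π b)) s s') s := by
  induction hacc generalizing s with
  | intro c _ ih =>
    refine .intro s fun s' hs' => ?_
    obtain ⟨c', h1, h2, -⟩ := hc.exists_silentStep hπ hs'
    exact ih c' h1 h2

theorem Simulates.exists_reaches {A : RWImpl n Op Res Reg Val Loc} {π : Bool → Fin n}
    (hπ : Function.Injective π) {c : Config n Op Res Reg Val Loc}
    {s s' : (Reg → Val) × (Bool → Loc)} (hc : Simulates π c s)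
    (hs : Relation.ReflTransGen (PairStep fun b => A.act (π b)) s s') :
    ∃ c', Reaches A c c' ∧ c'.log = c.log ∧ Simulates π c' s' ∧ c'.pend = c.pend ∧
      ∀ j, (∀ b, j ≠ π b) → c'.proc j = c.proc j := by
  induction hs with
  | refl => exact ⟨c, .refl, rfl, hc, rfl, fun _ _ => rfl⟩
  | tail _ hs ih =>
    obtain ⟨c', h1, h2, h3, h4, h5⟩ := ih
    obtain ⟨c'', g1, g3, g4, g5⟩ := h3.exists_silentStep hπ hs
    exact ⟨c'', h1.tail g1.1, g1.2.trans h2, g3, g4.trans h4,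
      fun j hj => (g5 j hj).trans (h5 j hj)⟩

end Executions

section Stack

variable {n : ℕ} {Reg Val Loc : Type}

theorem Linearization.exists_perm_log {cfg : Config n StackOp StackRes Reg Val Loc}
    (H : Linearization (historyAt cfg)) (hpend : ∀ i, cfg.pend i = none) :
    ∃ L : List (LogEntry n StackOp StackRes), L.Perm cfg.log ∧
      L.Pairwise (fun a b => ¬ b.retT < a.invT) ∧
      ∃ qf, SeqStackExec [] (L.map fun e => (e.op, e.res)) qf := by
  have hlen : (historyAt cfg).m = cfg.log.length := by
    have : pendingList cfg = [] := by
      simp [pendingList, hpend]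
    simp [historyAt, this]
  have hlt : ∀ k : Fin (historyAt cfg).m, (k : ℕ) < cfg.log.length := fun k => hlen ▸ k.2
  let g : Fin (historyAt cfg).m → LogEntry n StackOp StackRes :=
    fun k => cfg.log.get ⟨k, hlt k⟩
  have hop : ∀ k, (historyAt cfg).op k = (g k).op := fun k => by simp [historyAt, g, hlt k]
  have hinv : ∀ k, (historyAt cfg).inv k = (g k).invT := fun k => by
    simp [historyAt, g, hlt k]
  have hret : ∀ k, (historyAt cfg).ret k = some (g k).retT := fun k => by
    simp [historyAt, g, hlt k]
  have hout : ∀ k, (historyAt cfg).out k = some (g k).res := fun k => by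
    simp [historyAt, g, hlt k]
  refine ⟨H.seq.map g, ?_, ?_, ?_⟩
  · have h1 : H.seq.Perm (List.finRange (historyAt cfg).m) :=
      (List.perm_ext_iff_of_nodup H.nodup (List.nodup_finRange _)).2 fun k => by
        simp [H.complete_mem k (by simp [hout])]
    have h2 : (List.finRange (historyAt cfg).m).map g = cfg.log :=
      List.ext_get (by simp [hlen]) fun k _ _ => by simp [g]
    rw [← h2]
    exact h1.map g
  · rw [List.pairwise_map, List.pairwise_iff_get]
    intro i j hij hlt'
    have := H.order j i ⟨_, hret _, by rw [hinv]; exact hlt'⟩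
    exact absurd hij (by simp only [Fin.lt_def]; omega)
  · obtain ⟨qf, h⟩ := H.valid
    refine ⟨qf, ?_⟩
    rw [List.map_map]
    convert h using 2
    funext k
    simp [hop, H.out_agree k _ (hout k)]

theorem SeqStackExec.exists_of_cons {q qf : List ℕ} {p : StackOp × StackRes}
    {ps : List (StackOp × StackRes)} (h : SeqStackExec q (p :: ps) qf) :
    ∃ q', SeqStackDelta q p q' ∧ SeqStackExec q' ps qf := by
  cases h with
  | cons h1 h2 => exact ⟨_, h1, h2⟩

theorem seqStackExec_push_pop {x : ℕ} {r₀ r : StackRes} {qf : List ℕ}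
    {ps : List (StackOp × StackRes)}
    (h : SeqStackExec [] ((.push x, r₀) :: (.pop, r) :: ps) qf) :
    r = .val x ∧ SeqStackExec [] ps qf := by
  obtain ⟨q₁, h1, h'⟩ := h.exists_of_cons
  obtain ⟨q₂, h2, hps⟩ := h'.exists_of_cons
  obtain ⟨_, h1, rfl⟩ | ⟨_, h1, -⟩ | ⟨-, -, h1⟩ := h1
  · cases h1
    obtain ⟨_, h2, -⟩ | ⟨_, h2, h3⟩ | ⟨h2, -⟩ := h2
    · cases h2
    · cases h2
      cases h3
      exact ⟨rfl, hps⟩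
    · cases h2
  · cases h1
  · cases h1

theorem seqStackExec_pop_nil {r : StackRes} {qf : List ℕ} {ps : List (StackOp × StackRes)}
    (h : SeqStackExec [] ((.pop, r) :: ps) qf) : r = .empty := by
  obtain ⟨q₁, h1, -⟩ := h.exists_of_cons
  have : q₁ = [] ∧ r = .empty := by simpa [SeqStackDelta] using h1
  exact this.2

theorem LinearizableImpl.exists_perm_log {A : RWImpl n StackOp StackRes Reg Val Loc}
    (hA : LinearizableImpl A) (i : Fin n) {c : Config n StackOp StackRes Reg Val Loc}
    (hc : Reaches A (initConfig A) c) (hproc : c.proc i = none)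
    (hpend : ∀ j, c.pend j = none) :
    ∃ L : List (LogEntry n StackOp StackRes), L.Perm c.log ∧
      L.Pairwise (fun a b => ¬ b.retT < a.invT) ∧
      ∃ qf, SeqStackExec [] (L.map fun e => (e.op, e.res)) qf := by
  have : Nonempty StackOp := ⟨.pop⟩
  obtain ⟨f, sched, hf⟩ := exists_runFrom A (c₀ := c) (i := i) (by simp [hproc, hpend])
  obtain ⟨d, sched', N, hd, hN⟩ := hc.exists_run hf
  obtain ⟨H⟩ := hA d sched' hd N
  have : d N = c := by simpa [hf.1] using hN 0
  rw [this] at H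
  exact H.exists_perm_log hpend

theorem LinearizableImpl.pop_eq_val {A : RWImpl n StackOp StackRes Reg Val Loc}
    (hA : LinearizableImpl A) {i j : Fin n} {c : Config n StackOp StackRes Reg Val Loc}
    (hc : Reaches A (initConfig A) c) (hproc : c.proc i = none)
    (hpend : ∀ j, c.pend j = none) {x t₀ t₁ u₀ u₁ : ℕ} {r₀ r : StackRes}
    (hlog : c.log = [⟨i, .push x, r₀, t₀, t₁⟩, ⟨j, .pop, r, u₀, u₁⟩]) (ht : t₁ < u₀) :
    r = .val x := by
  obtain ⟨L, hL, hpw, qf, hex⟩ := hA.exists_perm_log i hc hproc hpend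
  rw [hlog, ← List.mem_permutations] at hL
  simp [List.permutations, List.permutationsAux, List.permutationsAux.rec] at hL
  rcases hL with rfl | rfl
  · exact (seqStackExec_push_pop hex).1
  · simp [ht.not_ge] at hpw

theorem LinearizableImpl.not_pop_eq_val_iff {A : RWImpl n StackOp StackRes Reg Val Loc}
    (hA : LinearizableImpl A) {i j j' : Fin n} {c : Config n StackOp StackRes Reg Val Loc}
    (hc : Reaches A (initConfig A) c) (hproc : c.proc i = none)
    (hpend : ∀ j, c.pend j = none) {x t₀ t₁ u₀ u₁ v₀ v₁ : ℕ} {r₀ r r' : StackRes}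
    (hlog : c.log = [⟨i, .push x, r₀, t₀, t₁⟩, ⟨j, .pop, r, u₀, u₁⟩, ⟨j', .pop, r', v₀, v₁⟩])
    (hu : t₁ < u₀) (hv : t₁ < v₀) : ¬ (r = .val x ↔ r' = .val x) := by
  obtain ⟨L, hL, hpw, qf, hex⟩ := hA.exists_perm_log i hc hproc hpend
  rw [hlog, ← List.mem_permutations] at hL
  simp [List.permutations, List.permutationsAux, List.permutationsAux.rec] at hL
  rcases hL with rfl | rfl | rfl | rfl | rfl | rfl <;>
    simp [hu.not_ge, hv.not_ge] at hpw
  all_goals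
    obtain ⟨h1, h2⟩ := seqStackExec_push_pop hex
    have h3 := seqStackExec_pop_nil h2
    simp only at h1 h3
    simp [h1, h3]

end Stack

/-- There is no non-blocking linearizable implementation of the sequential stack
from read/write registers, for two or more asynchronous crash-prone processes
(otherwise two processes could solve consensus using only read/write registers,
which is impossible). -/
theorem no_nonBlocking_linearizable_rw_stack (n : ℕ) (hn : 2 ≤ n) :
    ¬ ∃ (Reg Val Loc : Type) (A : RWImpl n StackOp StackRes Reg Val Loc),
        NonBlocking A ∧ LinearizableImpl A := by
  rintro ⟨Reg, Val, Loc, A, hNB, hLin⟩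
  obtain ⟨π, hπ⟩ : ∃ π : Bool → Fin n, Function.Injective π :=
    ⟨fun b => if b then ⟨0, by omega⟩ else ⟨1, by omega⟩, by
      rintro (_ | _) (_ | _) <;> simp⟩
  -- `π true` pushes an item alone, reaching `c₁`
  have hpush := Step.inv (A := A) (initConfig A) (π true) (.push 1) rfl rfl
  have hpushR : Reaches A (initConfig A) _ := .single ⟨_, hpush⟩
  obtain ⟨r₀, hr₀⟩ := exists_soloReturns_of_acc_silentStep (hNB.acc_silentStep hpushR)
    (Function.update_self _ _ _)
  obtain ⟨c₁, t₁, hR₁, hlog₁, hproc₁, hpend₁, ht₁⟩ :=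
    hr₀.exists_reaches rfl (Function.update_self _ _ _) (Function.update_self _ _ _)
  replace hR₁ := hpushR.trans hR₁
  have hproc₁ : ∀ j, c₁.proc j = none := by
    intro j; rw [hproc₁]; by_cases hj : j = π true <;> simp [hj, initConfig]
  have hpend₁ : ∀ j, c₁.pend j = none := by
    intro j; rw [hpend₁]; by_cases hj : j = π true <;> simp [hj, initConfig]
  simp only [initConfig, List.nil_append] at hlog₁
  -- both processes invoke a pop, reaching `c₃`
  have hinv := fun b => Step.inv (A := A) c₁ (π b) StackOp.pop (hproc₁ _) (hpend₁ _)
  have hne : π false ≠ π true := hπ.ne (by simp)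
  obtain ⟨c₃, hc₃⟩ : ∃ c₃, c₃ = ({ c₁ with
      proc := Function.update (Function.update c₁.proc (π true)
        (some (A.start (π true) .pop))) (π false) (some (A.start (π false) .pop))
      pend := Function.update (Function.update c₁.pend (π true)
        (some (.pop, c₁.time))) (π false) (some (.pop, c₁.time + 1))
      time := c₁.time + 1 + 1 } : Config n StackOp StackRes Reg Val Loc) := ⟨_, rfl⟩
  have hR₃ : Reaches A (initConfig A) c₃ := by
    refine (hR₁.tail ⟨_, hinv true⟩).tail ⟨π false, ?_⟩
    rw [hc₃]
    refine Step.inv _ (π false) StackOp.pop ?_ ?_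
    · simp [hne, hproc₁]
    · simp [hne, hpend₁]
  have hsim : Simulates π c₃ (c₁.regs, fun b => A.start (π b) .pop) := by
    subst hc₃
    exact ⟨rfl, by rintro (_ | _) <;> simp [hne.symm]⟩
  refine no_rw_election (fun b => A.act (π b)) (.val 1) (c₁.regs, fun b => A.start (π b) .pop)
    (hsim.acc_pairStep hπ (hNB.acc_silentStep hR₃)) ?_ ?_
  · intro s hs r hr
    obtain ⟨c, hRc, hlog, hsimc, hpend, -⟩ := hsim.exists_reaches hπ hs
    obtain ⟨d, u, hRd, hlogd, hprocd, hpendd, -⟩ :=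
      (SoloReturns.done (R := c.regs) (hr true)).exists_reaches (c := c) (op := .pop)
        (t₀ := c₁.time) rfl (hsimc.2 true) (by rw [hpend, hc₃]; simp [hne.symm])
    obtain ⟨e, v, hRe, hloge, hproce, hpende, -⟩ :=
      (SoloReturns.done (R := d.regs) (hr false)).exists_reaches (c := d) (op := .pop)
        (t₀ := c₁.time + 1) rfl (by rw [hprocd]; simp [hne, hsimc.2 false])
        (by rw [hpendd, hpend, hc₃]; simp [hne])
    refine hLin.not_pop_eq_val_iff (((hR₃.trans hRc).trans hRd).trans hRe) (i := π true)
      (by rw [hproce, hprocd]; simp [hne.symm]) ?_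
      (by rw [hloge, hlogd, hlog, hc₃]; simp only [hlog₁]; rfl) ht₁ (by omega)
    intro j
    rw [hpende, hpendd, hpend, hc₃]
    simp only [Function.update_apply, hpend₁]
    split_ifs <;> rfl
  · intro b r hr
    obtain ⟨d, u, hRd, hlogd, hprocd, hpendd, -⟩ :=
      hr.exists_reaches (c := { c₁ with
        proc := Function.update c₁.proc (π b) (some (A.start (π b) .pop)),
        pend := Function.update c₁.pend (π b) (some (.pop, c₁.time)),
        time := c₁.time + 1 }) rfl (Function.update_self _ _ _) (Function.update_self _ _ _)
    refine hLin.pop_eq_val ((hR₁.tail ⟨_, hinv b⟩).trans hRd) (i := π true)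
      (by rw [hprocd]; simp only [Function.update_apply, hproc₁]; split_ifs <;> rfl) ?_
      (by rw [hlogd]; simp only [hlog₁]; rfl) ht₁
    intro j
    rw [hpendd]
    simp only [Function.update_apply, hpend₁]
    split_ifs <;> rfl
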